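/- Let k ≤ n and m be positive integers, let Δ be a positive integer, let W ∈ ℤ^{m×n} have all square-submatrix determinants of absolute value at most Δ, and let w ∈ ℤᵐ. Let S = {x ∈ ℤⁿ : Wx ≤ w}, let q₁,…,q_k > 0 and h ∈ ℝⁿ, and define f(x) = Σ_{i=1}^k (−q_i x_i²) + Σ_{i=1}^n h_i x_i. Suppose x* ∈ S satisfies f(x*) ≤ f(x) for all x ∈ S. For each i = 1,…,k suppose l_i = min{x_i : x ∈ S} and u_i = max{x_i : x ∈ S} exist, let γ = max{q_i(u_i − l_i)² : i = 1,…,k}, let ε ∈ (0,1], and let g > 0 be a real number with u_i − l_i ≥ g for all i = 1,…,k and g² ≥ k((2nΔ)² + 1/ε). Then for every x◇ ∈ S with f(x◇) − f(x*) ≤ γk/(4g²), there exists x^Υ ∈ S such that f(x◇) − f(x*) ≤ ε (f(x^Υ) − f(x*)); in particular, if f attains its maximum value f_max on S, then f(x◇) − f(x*) ≤ ε (f_max − f(x*)), i.e., x◇ is an ε-approximate solution. -/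

import Mathlib

section

variable {E ι : Type*} [AddCommGroup E] [Module ℝ E] [Fintype ι]

/-- Moving from a point of a polyhedral cone along a direction that leaves the cone, until a new
constraint becomes tight. -/
lemma exists_add_smul_mem_cone_tight (φ : ι → E →ₗ[ℝ] ℝ) {v p : E} (hv : ∀ j, 0 ≤ φ j v)
    (hneg : ∃ j, φ j p < 0) :
    ∃ s : ℝ, 0 ≤ s ∧ (∀ j, 0 ≤ φ j (v + s • p)) ∧ ∃ j, φ j p ≠ 0 ∧ φ j (v + s • p) = 0 := by
  classical
  obtain ⟨j₀, hj₀⟩ := hneg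
  obtain ⟨i, hi, hmin⟩ := Finset.exists_min_image (Finset.univ.filter fun j => φ j p < 0)
    (fun j => φ j v / -(φ j p)) ⟨j₀, by simpa using hj₀⟩
  simp only [Finset.mem_filter, Finset.mem_univ, true_and] at hi hmin
  have hs : 0 ≤ φ i v / -(φ i p) := div_nonneg (hv i) (by linarith)
  refine ⟨φ i v / -(φ i p), hs, fun j => ?_, i, hi.ne, ?_⟩
  · simp only [map_add, map_smul, smul_eq_mul]
    rcases lt_or_ge (φ j p) 0 with hj | hj
    · have := hmin j hj
      rw [le_div_iff₀ (by linarith)] at this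
      linarith
    · have := mul_nonneg hs hj
      linarith [hv j]
  · simp only [map_add, map_smul, smul_eq_mul]
    field_simp [hi.ne]
    ring

/-- A nonzero point of a pointed polyhedral cone has an extreme ray in its minimal face. -/
lemma exists_extreme_ray (φ : ι → E →ₗ[ℝ] ℝ) (hφ : ∀ x, (∀ j, φ j x = 0) → x = 0) {v : E}
    (hv : ∀ j, 0 ≤ φ j v) (hv0 : v ≠ 0) :
    ∃ r : E, r ≠ 0 ∧ (∀ j, 0 ≤ φ j r) ∧ (∀ j, φ j v = 0 → φ j r = 0) ∧
      ∀ p, (∀ j, φ j r = 0 → φ j p = 0) → ∃ c : ℝ, p = c • r := by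
  classical
  induction hN : (Finset.univ.filter fun j => φ j v ≠ 0).card using Nat.strong_induction_on
    generalizing v with
  | _ N ih =>
  by_cases hext : ∀ p, (∀ j, φ j v = 0 → φ j p = 0) → ∃ c : ℝ, p = c • v
  · exact ⟨v, hv0, hv, fun _ h => h, hext⟩
  push Not at hext
  obtain ⟨p, hp, hpv⟩ := hext
  have hp0 : p ≠ 0 := fun h => hpv 0 (by simpa using h)
  have key : ∃ p, (∀ j, φ j v = 0 → φ j p = 0) ∧ (∀ c : ℝ, p ≠ c • v) ∧ ∃ j, φ j p < 0 := by
    by_cases hneg : ∃ j, φ j p < 0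
    · exact ⟨p, hp, hpv, hneg⟩
    · push Not at hneg
      refine ⟨-p, fun j h => by simpa using hp j h, fun c h => hpv (-c) ?_, ?_⟩
      · rw [neg_smul, ← h, neg_neg]
      · by_contra hcon
        push Not at hcon
        refine hp0 (hφ p fun j => le_antisymm ?_ (hneg j))
        simpa using hcon j
  obtain ⟨p, hp, hpv, hneg⟩ := key
  obtain ⟨s, -, hcone, j, hjp, hj⟩ := exists_add_smul_mem_cone_tight φ hv hneg
  have htight : ∀ j, φ j v = 0 → φ j (v + s • p) = 0 := fun j h => by simp [h, hp j h]
  have hne : v + s • p ≠ 0 := by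
    intro h
    rcases eq_or_ne s 0 with rfl | hs
    · exact hv0 (by simpa using h)
    · refine hpv (-s⁻¹) ?_
      rw [eq_neg_of_add_eq_zero_left h, smul_neg, neg_smul, neg_neg, smul_smul,
        inv_mul_cancel₀ hs, one_smul]
  obtain ⟨r, h1, h2, h3, h4⟩ := ih _ (by
    rw [← hN]
    refine Finset.card_lt_card (Finset.ssubset_iff_subset_ne.2 ⟨fun i => ?_, fun h => ?_⟩)
    · simpa using mt (htight i)
    · have : j ∈ Finset.univ.filter fun j => φ j v ≠ 0 := by simpa using mt (hp j) hjp
      rw [← h] at this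
      exact (Finset.mem_filter.1 this).2 hj) hcone hne rfl
  exact ⟨r, h1, h2, fun j h => h3 j (htight j h), h4⟩

/-- Carathéodory-type decomposition of a point of a pointed polyhedral cone, using generators taken
from a class of vectors that meets every nonzero face. -/
lemma exists_conic_decomposition [FiniteDimensional ℝ E] (φ : ι → E →ₗ[ℝ] ℝ)
    (hφ : ∀ x, (∀ j, φ j x = 0) → x = 0) (G : E → Prop) (hG0 : G 0)
    (hG : ∀ v, (∀ j, 0 ≤ φ j v) → v ≠ 0 →
      ∃ r, r ≠ 0 ∧ (∀ j, 0 ≤ φ j r) ∧ (∀ j, φ j v = 0 → φ j r = 0) ∧ G r)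
    (d : ℕ) {v : E} (hv : ∀ j, 0 ≤ φ j v)
    (hd : Module.finrank ℝ (⨅ j, ⨅ _ : φ j v = 0, LinearMap.ker (φ j) : Submodule ℝ E) ≤ d) :
    ∃ (c : Fin d → ℝ) (r : Fin d → E), (∀ t, 0 ≤ c t) ∧ (∀ t j, 0 ≤ φ j (r t)) ∧
      (∀ t, G (r t)) ∧ v = ∑ t, c t • r t := by
  induction d generalizing v with
  | zero =>
    refine ⟨0, 0, by simp, by simp, fun t => t.elim0, ?_⟩
    have h0 := Submodule.finrank_eq_zero.1 (Nat.le_zero.1 hd)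
    have : v ∈ (⨅ j, ⨅ _ : φ j v = 0, LinearMap.ker (φ j) : Submodule ℝ E) := by
      simp [Submodule.mem_iInf]
    rw [h0] at this
    simpa using this
  | succ d ih =>
    rcases eq_or_ne v 0 with rfl | hv0
    · exact ⟨0, 0, by simp, by simp, fun t => hG0, by simp⟩
    obtain ⟨r, hr0, hr, hrt, hGr⟩ := hG v hv hv0
    obtain ⟨s, hs, hcone, j, hjp, hj⟩ := exists_add_smul_mem_cone_tight φ (p := -r) hv
      (by
        by_contra hcon
        push Not at hcon
        exact hr0 (hφ r fun j => le_antisymm (by simpa using hcon j) (hr j)))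
    have hlt : (⨅ j, ⨅ _ : φ j (v + s • -r) = 0, LinearMap.ker (φ j) : Submodule ℝ E) <
        (⨅ j, ⨅ _ : φ j v = 0, LinearMap.ker (φ j) : Submodule ℝ E) := by
      rw [SetLike.lt_iff_le_and_exists]
      refine ⟨fun x hx => ?_, r, ?_, ?_⟩
      · simp only [Submodule.mem_iInf, LinearMap.mem_ker] at hx ⊢
        exact fun j h => hx j (by simp [h, hrt j h])
      · simpa only [Submodule.mem_iInf, LinearMap.mem_ker] using hrt
      · simp only [Submodule.mem_iInf, LinearMap.mem_ker]
        exact fun h => hjp (by simp [h j hj])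
    obtain ⟨c, ρ, h1, h2, h3, h4⟩ := ih hcone
      (Nat.le_of_lt_succ ((Submodule.finrank_lt_finrank_of_lt hlt).trans_le hd))
    refine ⟨Fin.cons s c, Fin.cons r ρ, Fin.cases hs h1, Fin.cases hr h2, Fin.cases hGr h3, ?_⟩
    rw [Fin.sum_univ_succ]
    simp only [Fin.cons_zero, Fin.cons_succ, ← h4]
    simp

end

/-- Adjoining rows of the identity matrix does not increase the largest subdeterminant. -/
lemma abs_det_fromRows_one_le {m n : Type*} [DecidableEq n] (W : Matrix m n ℤ) (Δ : ℤ)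
    (hW : ∀ (s : ℕ) (r : Fin s → m) (c : Fin s → n),
      Function.Injective r → Function.Injective c → |(W.submatrix r c).det| ≤ Δ)
    (s : ℕ) (ρ : Fin s → m ⊕ n) (c : Fin s → n) (hc : Function.Injective c) :
    |((Matrix.fromRows W (1 : Matrix n n ℤ)).submatrix ρ c).det| ≤ Δ := by
  have hΔ : 0 ≤ Δ := (abs_nonneg _).trans
    (hW 0 Fin.elim0 Fin.elim0 (fun a => a.elim0) (fun a => a.elim0))
  induction s with
  | zero =>
    simpa using hW 0 Fin.elim0 Fin.elim0 (fun a => a.elim0) (fun a => a.elim0)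
  | succ s ih =>
    by_cases hinr : ∃ a i, ρ a = Sum.inr i
    · obtain ⟨a, i, ha⟩ := hinr
      rw [Matrix.det_succ_row _ a]
      by_cases hi : ∃ b, c b = i
      · obtain ⟨b, rfl⟩ := hi
        rw [Finset.sum_eq_single b]
        · simp only [Matrix.submatrix_apply, ha, Matrix.fromRows_apply_inr, Matrix.one_apply_eq,
            mul_one, abs_mul, abs_pow, abs_neg, abs_one, one_pow, one_mul, Matrix.submatrix_submatrix]
          exact ih _ _ (hc.comp Fin.succAbove_right_injective)
        · intro b' _ hb'
          simp [ha, Matrix.one_apply_ne (fun h => hb' (hc h).symm)]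
        · simp
      · push Not at hi
        rw [Finset.sum_eq_zero]
        · simpa using hΔ
        · intro b _
          simp [ha, Matrix.one_apply_ne (hi b).symm]
    · have hinl : ∀ a, ∃ j, ρ a = Sum.inl j := fun a => by
        rcases h : ρ a with j | i
        · exact ⟨j, rfl⟩
        · exact (hinr ⟨a, i, h⟩).elim
      choose r hr using hinl
      have hsub : (Matrix.fromRows W (1 : Matrix n n ℤ)).submatrix ρ c = W.submatrix r c := by
        ext a b
        simp [hr]
      rw [hsub]
      by_cases hrinj : Function.Injective r
      · exact hW _ _ _ hrinj hc
      · simp only [Function.Injective] at hrinj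
        push Not at hrinj
        obtain ⟨a, b, hab, hne⟩ := hrinj
        rw [Matrix.det_zero_of_row_eq hne (by ext; simp [hab])]
        simpa using hΔ

/-- An extreme ray of the cone cut out by sign conditions on the rows of `W` and on the coordinates
contains a nonzero integer vector whose entries are bounded by the subdeterminants of `W`. -/
lemma exists_int_smul_extreme_ray {m : Type*} {n : ℕ} (W : Matrix m (Fin n) ℤ) (Δ : ℤ)
    (hW : ∀ (s : ℕ) (r : Fin s → m) (c : Fin s → Fin n),
      Function.Injective r → Function.Injective c → |(W.submatrix r c).det| ≤ Δ)
    (A : Matrix (m ⊕ Fin n) (Fin n) ℝ)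
    (hA : A = (Matrix.fromRows W (1 : Matrix (Fin n) (Fin n) ℤ)).map (Int.cast : ℤ → ℝ))
    {r : Fin n → ℝ} (hr : r ≠ 0)
    (hext : ∀ p, (∀ j, A j ⬝ᵥ r = 0 → A j ⬝ᵥ p = 0) → ∃ c : ℝ, p = c • r) :
    ∃ (z : Fin n → ℤ) (c : ℝ), 0 < c ∧ (∀ i, |z i| ≤ Δ) ∧ (fun i => (z i : ℝ)) = c • r := by
  classical
  obtain ⟨i₀, hi₀⟩ := Function.ne_iff.1 hr
  rw [Pi.zero_apply] at hi₀
  have hunit : ∀ (i : Fin n) (x : Fin n → ℝ), A (Sum.inr i) ⬝ᵥ x = x i := by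
    intro i x
    simp [hA, dotProduct, Matrix.one_apply]
  obtain ⟨κ, a, ha, hspan, hli⟩ := exists_linearIndependent' ℝ
    (fun j : {j // A j ⬝ᵥ r = 0 ∨ j = Sum.inr i₀} => A j)
  have htop : Submodule.span ℝ
      (Set.range (fun j : {j // A j ⬝ᵥ r = 0 ∨ j = Sum.inr i₀} => A j)) = ⊤ := by
    by_contra hne
    obtain ⟨f, hf0, hf⟩ := Submodule.exists_le_ker_of_lt_top _ (lt_top_iff_ne_top.2 hne)
    have hfx : ∀ x, f x = x ⬝ᵥ fun i => f (Pi.single i 1) := by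
      intro x
      conv_lhs => rw [← Finset.univ_sum_single x]
      rw [map_sum, dotProduct]
      refine Finset.sum_congr rfl fun i _ => ?_
      rw [← smul_eq_mul, ← map_smul, ← Pi.single_smul, smul_eq_mul, mul_one]
    have hfA : ∀ j, A j ⬝ᵥ r = 0 ∨ j = Sum.inr i₀ → A j ⬝ᵥ (fun i => f (Pi.single i 1)) = 0 := by
      intro j hj
      rw [← hfx]
      exact hf (Submodule.subset_span ⟨⟨j, hj⟩, rfl⟩)
    obtain ⟨c, hc⟩ := hext _ fun j hj => hfA j (Or.inl hj)
    have h0 := hfA _ (Or.inr rfl)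
    rw [hc, hunit, Pi.smul_apply, smul_eq_mul] at h0
    have hc0 : c = 0 := (mul_eq_zero.1 h0).resolve_right hi₀
    refine hf0 (LinearMap.ext fun x => ?_)
    rw [hfx, hc, hc0]
    simp
  let e := (Module.Basis.mk hli (hspan.trans htop).ge).indexEquiv (Pi.basisFun ℝ (Fin n))
  obtain ⟨ρ, hρ⟩ : ∃ ρ : Fin n → m ⊕ Fin n, ρ = fun t => (a (e.symm t)).1 := ⟨_, rfl⟩
  have hρT : ∀ t, A (ρ t) ⬝ᵥ r = 0 ∨ ρ t = Sum.inr i₀ := fun t => hρ ▸ (a (e.symm t)).2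
  have hρinj : Function.Injective ρ := by
    rw [hρ]
    exact Subtype.val_injective.comp (ha.comp e.symm.injective)
  have hρli : LinearIndependent ℝ (A.submatrix ρ id).row := by
    rw [hρ]
    exact hli.comp _ e.symm.injective
  have hdet : (A.submatrix ρ id).det ≠ 0 :=
    ((Matrix.isUnit_iff_isUnit_det _).1
      (Matrix.linearIndependent_rows_iff_isUnit.1 hρli)).ne_zero
  obtain ⟨M, hM⟩ : ∃ M, M = (Matrix.fromRows W (1 : Matrix (Fin n) (Fin n) ℤ)).submatrix ρ id :=
    ⟨_, rfl⟩
  have hMA : M.map (Int.cast : ℤ → ℝ) = A.submatrix ρ id := by rw [hM, hA]; rfl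
  have hadj : ∀ i t, |M.adjugate i t| ≤ Δ := by
    intro i t
    rw [Matrix.adjugate_apply]
    convert abs_det_fromRows_one_le W Δ hW n (Function.update ρ t (Sum.inr i)) id
      Function.injective_id using 3
    ext x y
    rcases eq_or_ne x t with rfl | hx
    · simp [Matrix.one_apply, Pi.single_apply, eq_comm]
    · simp [hx, hM]
  have hex : ∃ t, ρ t = Sum.inr i₀ := by
    by_contra hcon
    push Not at hcon
    refine hr (Matrix.eq_zero_of_mulVec_eq_zero hdet (funext fun t => ?_))
    exact (hρT t).resolve_right (hcon t)
  obtain ⟨t₀, ht₀⟩ := hex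
  have hMr : (A.submatrix ρ id).mulVec r = Pi.single t₀ (r i₀) := by
    ext t
    rcases eq_or_ne t t₀ with rfl | ht
    · rw [Pi.single_eq_same, ← hunit i₀ r, ← ht₀]; rfl
    · rw [Pi.single_eq_of_ne ht]
      exact (hρT t).resolve_right fun h => ht (hρinj (h.trans ht₀.symm))
  have hcol : ∀ i, (M.adjugate i t₀ : ℝ) = (A.submatrix ρ id).det / r i₀ * r i := by
    intro i
    have h1 : ((A.submatrix ρ id).adjugate.mulVec ((A.submatrix ρ id).mulVec r)) i =
        (A.submatrix ρ id).det * r i := by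
      rw [Matrix.mulVec_mulVec, Matrix.adjugate_mul, Matrix.smul_mulVec, Matrix.one_mulVec]
      rfl
    have h2 : (A.submatrix ρ id).adjugate i t₀ = (M.adjugate i t₀ : ℝ) := by
      rw [← hMA]
      exact (congrFun (congrFun ((Int.castRingHom ℝ).map_adjugate M) i) t₀).symm
    rw [hMr] at h1
    simp only [Matrix.mulVec_single, Matrix.col_apply, Pi.smul_apply, MulOpposite.smul_eq_mul_unop,
      MulOpposite.unop_op, h2] at h1
    rw [div_mul_eq_mul_div, eq_div_iff hi₀]
    exact h1
  have hc0 : (A.submatrix ρ id).det / r i₀ ≠ 0 := div_ne_zero hdet hi₀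
  rcases hc0.lt_or_gt with hc | hc
  · refine ⟨fun i => -M.adjugate i t₀, _, neg_pos.2 hc, fun i => by simpa using hadj i t₀, ?_⟩
    ext i
    simp [hcol]
  · refine ⟨fun i => M.adjugate i t₀, _, hc, fun i => hadj i t₀, ?_⟩
    ext i
    simp [hcol]

/-- Every real vector `v` has an integer vector close to `v / 2` whose image under each row of `W`
lies between `0` and the image of `v`. -/
lemma exists_int_near_half {m : Type*} [Fintype m] {n : ℕ} (W : Matrix m (Fin n) ℤ) (Δ : ℕ)
    (hW : ∀ (s : ℕ) (r : Fin s → m) (c : Fin s → Fin n),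
      Function.Injective r → Function.Injective c → |(W.submatrix r c).det| ≤ (Δ : ℤ))
    (v : Fin n → ℝ) :
    ∃ a : Fin n → ℤ, (∀ i, |2 * (a i : ℝ) - v i| ≤ 2 * n * Δ) ∧
      ∀ j, (∑ i, (W j i : ℝ) * a i) ∈ Set.uIcc 0 (∑ i, (W j i : ℝ) * v i) := by
  classical
  obtain ⟨A, hA⟩ : ∃ A : Matrix (m ⊕ Fin n) (Fin n) ℝ,
      A = (Matrix.fromRows W (1 : Matrix (Fin n) (Fin n) ℤ)).map (Int.cast : ℤ → ℝ) := ⟨_, rfl⟩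
  obtain ⟨σ, hσ⟩ : ∃ σ : m ⊕ Fin n → ℝ, ∀ j,
      (0 ≤ A j ⬝ᵥ v ∧ σ j = 1) ∨ (A j ⬝ᵥ v < 0 ∧ σ j = -1) := by
    refine ⟨fun j => if 0 ≤ A j ⬝ᵥ v then 1 else -1, fun j => ?_⟩
    by_cases h : 0 ≤ A j ⬝ᵥ v
    · simp [h]
    · simp [h, lt_of_not_ge h]
  have hσ0 : ∀ j, σ j ≠ 0 := fun j => by rcases hσ j with h | h <;> simp [h.2]
  obtain ⟨φ, hφ⟩ : ∃ φ : m ⊕ Fin n → (Fin n → ℝ) →ₗ[ℝ] ℝ, ∀ j x, φ j x = σ j * (A j ⬝ᵥ x) :=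
    ⟨fun j => σ j • (LinearMap.proj j ∘ₗ A.mulVecLin), fun j x => rfl⟩
  have hφ0 : ∀ j x, φ j x = 0 ↔ A j ⬝ᵥ x = 0 := fun j x => by simp [hφ, hσ0]
  have hpointed : ∀ x, (∀ j, φ j x = 0) → x = 0 := by
    intro x hx
    ext i
    have := (hφ0 _ _).1 (hx (Sum.inr i))
    simpa [hA, dotProduct, Matrix.one_apply] using this
  have hv : ∀ j, 0 ≤ φ j v := by
    intro j
    rcases hσ j with h | h <;> rw [hφ, h.2] <;> linarith [h.1]
  obtain ⟨c, r, hc, hr, hz, hsum⟩ := exists_conic_decomposition φ hpointed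
    (fun r => ∃ z : Fin n → ℤ, (∀ i, |z i| ≤ (Δ : ℤ)) ∧ r = fun i => (z i : ℝ))
    ⟨0, by simp, by ext; simp⟩
    (by
      intro v hv hv0
      obtain ⟨r, hr0, hr, hrt, hext⟩ := exists_extreme_ray φ hpointed hv hv0
      obtain ⟨z, c, hc, hzΔ, hzr⟩ := exists_int_smul_extreme_ray W Δ hW A hA hr0
        (by simpa only [hφ0] using hext)
      refine ⟨c • r, smul_ne_zero hc.ne' hr0, fun j => ?_, fun j hj => ?_, z, hzΔ, hzr.symm⟩
      · rw [map_smul]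
        exact mul_nonneg hc.le (hr j)
      · rw [map_smul, hrt j hj, smul_zero])
    n hv ((Submodule.finrank_le _).trans (by simp))
  choose z hzΔ hrz using hz
  have hvi : ∀ i, v i = ∑ t, c t * z t i := by
    intro i
    rw [hsum]
    simp [hrz]
  have hacast : (fun i => ((∑ t, ⌊c t / 2⌋ * z t i : ℤ) : ℝ)) = ∑ t, (⌊c t / 2⌋ : ℝ) • r t := by
    ext i
    simp [hrz]
  have hfloor : ∀ t, (0 : ℝ) ≤ ⌊c t / 2⌋ ∧ (⌊c t / 2⌋ : ℝ) ≤ c t / 2 ∧ c t / 2 < ⌊c t / 2⌋ + 1 :=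
    fun t => ⟨by exact_mod_cast Int.floor_nonneg.2 (div_nonneg (hc t) zero_le_two),
      Int.floor_le _, Int.lt_floor_add_one _⟩
  refine ⟨fun i => ∑ t, ⌊c t / 2⌋ * z t i, fun i => ?_, fun j => ?_⟩
  · push_cast
    rw [hvi, Finset.mul_sum, ← Finset.sum_sub_distrib]
    refine (Finset.abs_sum_le_sum_abs _ _).trans
      ((Finset.sum_le_card_nsmul _ _ (2 * Δ : ℝ) fun t _ => ?_).trans (by simp; linarith))
    obtain ⟨h1, h2, h3⟩ := hfloor t
    have hzt : |(z t i : ℝ)| ≤ Δ := by exact_mod_cast hzΔ t i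
    rw [← mul_assoc, ← sub_mul, abs_mul]
    exact mul_le_mul (abs_le.2 ⟨by linarith, by linarith⟩) hzt (abs_nonneg _) zero_le_two
  · have key1 : 0 ≤ φ (Sum.inl j) (∑ t, (⌊c t / 2⌋ : ℝ) • r t) := by
      rw [map_sum]
      refine Finset.sum_nonneg fun t _ => ?_
      rw [map_smul]
      exact mul_nonneg (hfloor t).1 (hr t _)
    have key2 : φ (Sum.inl j) (∑ t, (⌊c t / 2⌋ : ℝ) • r t) ≤ φ (Sum.inl j) v := by
      conv_rhs => rw [hsum]
      rw [map_sum, map_sum]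
      refine Finset.sum_le_sum fun t _ => ?_
      rw [map_smul, map_smul]
      exact mul_le_mul_of_nonneg_right (by linarith [hfloor t, hc t]) (hr t _)
    rw [← hacast, hφ] at key1 key2
    rw [hφ] at key2
    have hAj : ∀ x, A (Sum.inl j) ⬝ᵥ x = ∑ i, (W j i : ℝ) * x i := fun x => by
      simp [hA, dotProduct]
    have hs := hσ (Sum.inl j)
    rw [hAj] at key1 key2 hs
    rw [hAj] at key2
    rw [Set.mem_uIcc]
    rcases hs with h | h
    · rw [h.2] at key1 key2
      exact Or.inl ⟨by linarith, by linarith⟩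
    · rw [h.2] at key1 key2
      exact Or.inr ⟨by linarith, by linarith⟩


/-- any feasible point within `γk/(4g²)` of the minimum is an `ε`-approximate
solution, when `g² ≥ k((2nΔ)² + 1/ε)`. -/
theorem stmt_13 (k n m : ℕ) (hk : 0 < k) (hkn : k ≤ n) (hm : 0 < m)
    (Δ : ℕ) (hΔ : 0 < Δ)
    (W : Matrix (Fin m) (Fin n) ℤ)
    (hW : ∀ (s : ℕ) (r : Fin s → Fin m) (c : Fin s → Fin n),
      Function.Injective r → Function.Injective c → |(W.submatrix r c).det| ≤ (Δ : ℤ))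
    (w : Fin m → ℤ)
    (S : Set (Fin n → ℝ))
    (hS : S = {x | (∀ i, ∃ z : ℤ, x i = (z : ℝ)) ∧
                   ∀ j, (∑ i, (W j i : ℝ) * x i) ≤ (w j : ℝ)})
    (q : Fin k → ℝ) (hq : ∀ i, 0 < q i) (h : Fin n → ℝ)
    (f : (Fin n → ℝ) → ℝ)
    (hf : ∀ x, f x = (∑ i : Fin k, -(q i) * (x (Fin.castLE hkn i)) ^ 2) + ∑ i, h i * x i)
    (xstar : Fin n → ℝ) (hxstarS : xstar ∈ S) (hxstar : ∀ x ∈ S, f xstar ≤ f x)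
    (l u : Fin k → ℝ)
    (hl : ∀ i, (∃ y ∈ S, y (Fin.castLE hkn i) = l i) ∧ ∀ y ∈ S, l i ≤ y (Fin.castLE hkn i))
    (hu : ∀ i, (∃ y ∈ S, y (Fin.castLE hkn i) = u i) ∧ ∀ y ∈ S, y (Fin.castLE hkn i) ≤ u i)
    (γ : ℝ)
    (hγmax : ∀ i, q i * (u i - l i) ^ 2 ≤ γ) (hγatt : ∃ i, γ = q i * (u i - l i) ^ 2)
    (ε : ℝ) (hε0 : 0 < ε) (hε1 : ε ≤ 1)
    (g : ℝ) (hg : 0 < g) (hgap : ∀ i, g ≤ u i - l i)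
    (hg2 : g ^ 2 ≥ k * ((2 * (n : ℝ) * (Δ : ℝ)) ^ 2 + 1 / ε))
    (xd : Fin n → ℝ) (hxdS : xd ∈ S)
    (hxd : f xd - f xstar ≤ γ * k / (4 * g ^ 2)) :
    (∃ xY ∈ S, f xd - f xstar ≤ ε * (f xY - f xstar)) ∧
    (∀ fmax : ℝ, (∃ y ∈ S, f y = fmax) → (∀ x ∈ S, f x ≤ fmax) →
      f xd - f xstar ≤ ε * (fmax - f xstar)) := by
  obtain ⟨i₀, hi₀⟩ := hγatt
  obtain ⟨xl, hxl, hxli⟩ := (hl i₀).1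
  obtain ⟨xu, hxu, hxui⟩ := (hu i₀).1
  obtain ⟨a, ha, haW⟩ := exists_int_near_half W Δ hW (xu - xl)
  obtain ⟨y, hy⟩ : ∃ y : Fin n → ℝ, ∀ i, y i = xl i + a i := ⟨_, fun _ => rfl⟩
  obtain ⟨z, hz⟩ : ∃ z : Fin n → ℝ, ∀ i, z i = xu i - a i := ⟨_, fun _ => rfl⟩
  have hyzS : y ∈ S ∧ z ∈ S := by
    rw [hS] at hxl hxu ⊢
    refine ⟨⟨fun i => ?_, fun j => ?_⟩, ⟨fun i => ?_, fun j => ?_⟩⟩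
    · obtain ⟨t, ht⟩ := hxl.1 i
      exact ⟨t + a i, by rw [hy, ht]; push_cast; rfl⟩
    · have h1 := hxl.2 j
      have h2 := hxu.2 j
      have h3 := haW j
      simp only [hy, mul_add, Finset.sum_add_distrib]
      simp only [Pi.sub_apply, mul_sub, Finset.sum_sub_distrib, Set.mem_uIcc] at h3
      rcases h3 with h3 | h3 <;> linarith
    · obtain ⟨t, ht⟩ := hxu.1 i
      exact ⟨t - a i, by rw [hz, ht]; push_cast; rfl⟩
    · have h1 := hxl.2 j
      have h2 := hxu.2 j
      have h3 := haW j
      simp only [hz, mul_sub, Finset.sum_sub_distrib]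
      simp only [Pi.sub_apply, mul_sub, Finset.sum_sub_distrib, Set.mem_uIcc] at h3
      rcases h3 with h3 | h3 <;> linarith
  obtain ⟨hyS, hzS⟩ := hyzS
  have hident : f y + f z - f xl - f xu = ∑ i : Fin k, q i / 2 *
      ((xu (Fin.castLE hkn i) - xl (Fin.castLE hkn i)) ^ 2 -
        (y (Fin.castLE hkn i) - z (Fin.castLE hkn i)) ^ 2) := by
    have hlin : ∑ i, h i * y i + ∑ i, h i * z i - ∑ i, h i * xl i - ∑ i, h i * xu i = 0 := by
      rw [← Finset.sum_add_distrib, ← Finset.sum_sub_distrib, ← Finset.sum_sub_distrib]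
      refine Finset.sum_eq_zero fun i _ => ?_
      rw [hy, hz]
      ring
    have hquad : ∀ i : Fin k, q i / 2 *
        ((xu (Fin.castLE hkn i) - xl (Fin.castLE hkn i)) ^ 2 -
          (y (Fin.castLE hkn i) - z (Fin.castLE hkn i)) ^ 2) =
        -(q i) * y (Fin.castLE hkn i) ^ 2 + -(q i) * z (Fin.castLE hkn i) ^ 2 -
          -(q i) * xl (Fin.castLE hkn i) ^ 2 - -(q i) * xu (Fin.castLE hkn i) ^ 2 := by
      intro i
      rw [hy, hz]
      ring
    simp only [hquad, Finset.sum_sub_distrib, Finset.sum_add_distrib, hf]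
    linarith
  have hγ0 : 0 ≤ γ := hi₀ ▸ mul_nonneg (hq i₀).le (sq_nonneg _)
  have hg2pos : 0 < g ^ 2 := by positivity
  have hlower : γ / 2 - k * (γ / g ^ 2 / 2 * (2 * n * Δ) ^ 2) ≤ f y + f z - f xl - f xu := by
    rw [hident]
    simp only [mul_sub, Finset.sum_sub_distrib]
    refine sub_le_sub ?_ ?_
    · refine le_trans (le_of_eq ?_) (Finset.single_le_sum
        (f := fun i : Fin k => q i / 2 *
          (xu (Fin.castLE hkn i) - xl (Fin.castLE hkn i)) ^ 2)
        (fun i _ => mul_nonneg (half_pos (hq i)).le (sq_nonneg _)) (Finset.mem_univ i₀))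
      simp only [hxui, hxli, hi₀]
      ring
    · refine (Finset.sum_le_card_nsmul _ _ (γ / g ^ 2 / 2 * (2 * n * Δ) ^ 2)
        fun i _ => ?_).trans (by simp)
      have hqi : q i ≤ γ / g ^ 2 := by
        rw [le_div_iff₀ hg2pos]
        refine le_trans ?_ (hγmax i)
        exact mul_le_mul_of_nonneg_left (pow_le_pow_left₀ hg.le (hgap i) 2) (hq i).le
      refine mul_le_mul (by linarith) ?_ (sq_nonneg _) (by positivity)
      rw [hy, hz]
      refine sq_le_sq' ?_ ?_ <;>
        have := abs_le.1 (ha (Fin.castLE hkn i)) <;> simp only [Pi.sub_apply] at this <;>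
        linarith
  have hsum : γ * k / (2 * g ^ 2) ≤ ε * (f y + f z - 2 * f xstar) := by
    have h1 := hxstar xl hxl
    have h2 := hxstar xu hxu
    refine le_trans ?_ (mul_le_mul_of_nonneg_left
      (show γ / 2 - k * (γ / g ^ 2 / 2 * (2 * n * Δ) ^ 2) ≤ _ by linarith) hε0.le)
    have h3 : (k : ℝ) ≤ ε * (g ^ 2 - k * (2 * n * Δ) ^ 2) := by
      have h4 : (k : ℝ) * (1 / ε) ≤ g ^ 2 - k * (2 * n * Δ) ^ 2 := by linarith
      have h5 := mul_le_mul_of_nonneg_left h4 hε0.le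
      have h6 : ε * (k * (1 / ε)) = k := by field_simp
      linarith
    have h7 : ε * (γ / 2 - k * (γ / g ^ 2 / 2 * (2 * n * Δ) ^ 2)) =
        γ * (ε * (g ^ 2 - k * (2 * n * Δ) ^ 2)) / (2 * g ^ 2) := by
      field_simp
    rw [h7]
    gcongr
  have hhalf : γ * k / (2 * g ^ 2) = 2 * (γ * k / (4 * g ^ 2)) := by
    field_simp
    norm_num
  have hexists : ∃ xY ∈ S, f xd - f xstar ≤ ε * (f xY - f xstar) := by
    rcases le_total (f z) (f y) with hle | hle
    · refine ⟨y, hyS, ?_⟩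
      have := mul_le_mul_of_nonneg_left hle hε0.le
      linarith
    · refine ⟨z, hzS, ?_⟩
      have := mul_le_mul_of_nonneg_left hle hε0.le
      linarith
  refine ⟨hexists, fun fmax _ hmax => ?_⟩
  obtain ⟨xY, hxY, hle⟩ := hexists
  have := mul_le_mul_of_nonneg_left (hmax xY hxY) hε0.le
  linarith
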